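/- Let F be an ordinary differential field of characteristic zero and E a differential field extension of F. Let u = (u_1,…,u_r) ∈ E^r and ȳ = (ȳ_1,…,ȳ_n) ∈ E^n be such that u_1,…,u_r are differentially independent over the differential subfield F⟨ȳ_1,…,ȳ_n⟩. Let P_1,…,P_m be differential polynomials over F in the differential variables u_1,…,u_r,y_1,…,y_n, and fix natural numbers σ_{ij} for 1 ≤ i ≤ m, 1 ≤ j ≤ n_i. If the finite family (δ^{σ_{ij}}(P_i(u,ȳ)) : 1 ≤ i ≤ m, 1 ≤ j ≤ n_i) is algebraically dependent over F⟨u_1,…,u_r⟩, then for every v_1,…,v_r ∈ F, the family (δ^{σ_{ij}}(P_i(v,ȳ)) : 1 ≤ i ≤ m, 1 ≤ j ≤ n_i) is algebraically dependent over F. -/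

import Mathlib

/-- A family `a : ι → E` is differentially independent over a subfield `K` of `E`
(w.r.t. a derivation `δ`) if the family of all its iterated derivatives is
algebraically independent over `K`. -/
def DiffIndep {E : Type*} [Field E] (δ : E → E) (K : Subfield E)
    {ι : Type*} (a : ι → E) : Prop :=
  AlgebraicIndependent K (fun p : ι × ℕ => δ^[p.2] (a p.1))

/-- The differential subfield `F⟨S⟩` of `E` generated by `F` and `S`: the subfield
generated by `F` together with all iterated derivatives of elements of `S`. -/
def diffAdjoin {E : Type*} [Field E] (δ : E → E) (F : Subfield E) (S : Set E) : Subfield E :=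
  Subfield.closure (↑F ∪ {x | ∃ s ∈ S, ∃ k : ℕ, δ^[k] s = x})

open MvPolynomial in
/-- If the constant coefficients of the `q i` are algebraically independent over `R`, then so are
the `q i` together with all the variables. -/
theorem AlgebraicIndependent.sumElim_X_of_constantCoeff {R S τ ι : Type*} [CommRing R] [CommRing S]
    [Algebra R S] {q : ι → MvPolynomial τ S}
    (h : AlgebraicIndependent R (fun i => constantCoeff (q i))) :
    AlgebraicIndependent R (Sum.elim q X : ι ⊕ τ → MvPolynomial τ S) := by
  classical
  rw [← algebraicIndependent_equiv' (Equiv.sumComm τ ι)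
    (g := (Sum.elim X q : τ ⊕ ι → MvPolynomial τ S)) (by ext (_ | _) <;> simp),
    algebraicIndependent_iff]
  intro G hG
  by_contra hG0
  set H := sumAlgEquiv R τ ι G with hH
  have hH0 : H ≠ 0 := by simpa [hH] using hG0
  have key : aeval (Sum.elim X q : τ ⊕ ι → MvPolynomial τ S) G =
      eval₂ (aeval q : MvPolynomial ι R →ₐ[R] MvPolynomial τ S).toRingHom X H := by
    rw [hH]
    clear hH0 hH H hG0 hG
    induction G using MvPolynomial.induction_on with
    | C a => simp
    | add p q hp hq => simp only [map_add, eval₂_add, hp, hq]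
    | mul_X p i hp =>
      rw [map_mul, map_mul, eval₂_mul, hp]
      rcases i with i | i <;> simp
  rw [hG, eval₂_eq] at key
  obtain ⟨α, hα⟩ := H.support.exists_minimal (by simpa using hH0)
  have hαz : constantCoeff (aeval q (H.coeff α)) = 0 := by
    have hc := congrArg (coeff α) key
    rw [coeff_zero, coeff_sum, Finset.sum_eq_single α] at hc
    · rw [← Finsupp.prod, ← monic_monomial_eq, coeff_mul_monomial'] at hc
      simp only [le_refl, if_true, tsub_self, mul_one] at hc
      exact hc.symm
    · intro β hβ hne
      rw [← Finsupp.prod, ← monic_monomial_eq, coeff_mul_monomial',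
        if_neg fun hle => hne (le_antisymm hle (hα.2 hβ hle))]
    · exact fun hn => absurd hα.1 hn
  refine mem_support_iff.mp hα.1 (h.eq_zero_of_aeval_eq_zero _ ?_)
  rw [← hαz]
  generalize H.coeff α = p
  induction p using MvPolynomial.induction_on with
  | C a => simp [IsScalarTower.algebraMap_apply R S (MvPolynomial τ S), algebraMap_eq]
  | add p q hp hq => simp only [map_add, hp, hq]
  | mul_X p i hp => simp [hp]

open MvPolynomial in
theorem AlgebraicIndependent.sub_algebraMap {R A ι : Type*} [CommRing R] [CommRing A] [Algebra R A]
    {x : ι → A} (h : AlgebraicIndependent R x) (c : ι → R) :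
    AlgebraicIndependent R (fun i => x i - algebraMap R A (c i)) := by
  have hs : Function.Injective (aeval fun i => X i - C (c i) :
      MvPolynomial ι R →ₐ[R] MvPolynomial ι R) := by
    refine Function.LeftInverse.injective (g := aeval fun i => X i + C (c i)) fun p => ?_
    rw [← AlgHom.comp_apply, show (aeval fun i => X i + C (c i)).comp
      (aeval fun i => X i - C (c i)) = AlgHom.id R (MvPolynomial ι R) by
        ext i; simp [algHom_C, algebraMap_eq]]
    rfl
  have hc : aeval (fun i => x i - algebraMap R A (c i)) =
      (aeval x).comp (aeval fun i => X i - C (c i) :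
        MvPolynomial ι R →ₐ[R] MvPolynomial ι R) := by
    ext i; simp [algHom_C]
  rw [AlgebraicIndependent, hc, AlgHom.coe_comp]
  exact Function.Injective.comp (g := aeval x) h hs

open scoped IntermediateField.algebraAdjoinAdjoin in
/-- Elements algebraically independent together with `x` over a field remain algebraically
independent over the subfield generated by `x`. -/
theorem AlgebraicIndependent.intermediateField_adjoin {K E ι τ : Type*} [Field K] [Field E]
    [Algebra K E] {y : ι → E} {x : τ → E} (h : AlgebraicIndependent K (Sum.elim y x)) :
    AlgebraicIndependent (IntermediateField.adjoin K (Set.range x)) y := by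
  have hy := (AlgebraicIndependent.sumElim_iff.mp h).2
  exact hy.extendScalars _

section Iterate

variable {E : Type*} [Field E]

theorem Subfield.algebraMap_eq_coe (K : Subfield E) (x : K) : algebraMap K E x = x := rfl

theorem le_diffAdjoin (δ : E → E) (F : Subfield E) (S : Set E) : F ≤ diffAdjoin δ F S :=
  fun _ hx => Subfield.subset_closure (Or.inl hx)

theorem iterate_mem_diffAdjoin (δ : E → E) (F : Subfield E) {S : Set E} {s : E} (hs : s ∈ S)
    (k : ℕ) : δ^[k] s ∈ diffAdjoin δ F S :=
  Subfield.subset_closure (Or.inr ⟨s, hs, k, rfl⟩)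

theorem iterate_mem_of_stable {δ : E → E} {F : Subfield E} (hF : ∀ x ∈ F, δ x ∈ F) {x : E}
    (hx : x ∈ F) (k : ℕ) : δ^[k] x ∈ F := by
  induction k with
  | zero => exact hx
  | succ k ih => rw [Function.iterate_succ_apply']; exact hF _ ih

/-- A differential subfield adjunction is stable under the derivation. -/
theorem Derivation.apply_mem_diffAdjoin (D : Derivation ℤ E E) {F : Subfield E}
    (hF : ∀ x ∈ F, D x ∈ F) {S : Set E} {x : E} (hx : x ∈ diffAdjoin D F S) :
    D x ∈ diffAdjoin D F S := by
  induction hx using Subfield.closure_induction with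
  | mem x hx =>
    rcases hx with hx | ⟨s, hs, k, rfl⟩
    · exact le_diffAdjoin _ _ _ (hF x hx)
    · rw [← Function.iterate_succ_apply' D]
      exact iterate_mem_diffAdjoin _ _ hs _
  | one => rw [D.map_one_eq_zero]; exact zero_mem _
  | add x y _ _ hx hy => rw [map_add]; exact add_mem hx hy
  | neg x _ hx => rw [map_neg]; exact neg_mem hx
  | inv x hxm hx =>
    rw [D.leibniz_inv]
    exact mul_mem (neg_mem (pow_mem (inv_mem hxm) 2)) hx
  | mul x y hxm hym hx hy =>
    rw [D.leibniz]
    exact add_mem (mul_mem hxm hy) (mul_mem hym hx)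

open MvPolynomial in
/-- Evaluation at a family of iterated derivatives and the constant coefficient are
compatible with the same lift of the derivation to polynomials. -/
theorem Derivation.exists_iterate_lift (D : Derivation ℤ E E) {K : Subfield E}
    (hK : ∀ x ∈ K, D x ∈ K) {ι : Type*} (w : ι → E) (p : MvPolynomial (ι × ℕ) K) (k : ℕ) :
    ∃ q : MvPolynomial (ι × ℕ) K,
      aeval (fun i => D^[i.2] (w i.1)) q = D^[k] (aeval (fun i => D^[i.2] (w i.1)) p) ∧
      ((constantCoeff q : K) : E) = D^[k] ((constantCoeff p : K) : E) := by
  have step (p : MvPolynomial (ι × ℕ) K) : ∃ q : MvPolynomial (ι × ℕ) K,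
      aeval (fun i => D^[i.2] (w i.1)) q = D (aeval (fun i => D^[i.2] (w i.1)) p) ∧
      ((constantCoeff q : K) : E) = D ((constantCoeff p : K) : E) := by
    induction p using MvPolynomial.induction_on with
    | C a => exact ⟨C ⟨D a, hK a a.2⟩, by simp [algHom_C, Subfield.algebraMap_eq_coe], by simp⟩
    | add p₁ p₂ h₁ h₂ =>
      obtain ⟨q₁, h₁, h₁'⟩ := h₁
      obtain ⟨q₂, h₂, h₂'⟩ := h₂
      exact ⟨q₁ + q₂, by simp [h₁, h₂], by simp [h₁', h₂']⟩
    | mul_X p i hp =>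
      obtain ⟨q, hq, hq'⟩ := hp
      refine ⟨p * X (i.1, i.2 + 1) + X i * q, ?_, by simp⟩
      simp only [map_add, map_mul, aeval_X, hq, Function.iterate_succ_apply', D.leibniz,
        smul_eq_mul]
  induction k with
  | zero => exact ⟨p, rfl, rfl⟩
  | succ k ih =>
    obtain ⟨q, hq, hq'⟩ := ih
    obtain ⟨q', h, h'⟩ := step q
    exact ⟨q', by rw [h, hq, Function.iterate_succ_apply'],
      by rw [h', hq', Function.iterate_succ_apply']⟩

end Iterate

/-- **Specialization of algebraic dependence among chosen derivatives of differential
polynomial values.**  If `u₁,…,u_r ∈ E` are differentially independent over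
`F⟨ȳ₁,…,ȳₙ⟩` and the finite family `(δ^{σ_{ij}}(P_i(u,ȳ)))` is algebraically dependent
over `F⟨u₁,…,u_r⟩`, then for every specialization of the `u`'s to elements
`v₁,…,v_r` of `F`, the family `(δ^{σ_{ij}}(P_i(v,ȳ)))` is algebraically dependent
over `F`. -/
theorem specialization_of_algebraic_dependence_of_derivatives
    {E : Type*} [Field E] [CharZero E] (δ : E → E)
    (hδadd : ∀ a b : E, δ (a + b) = δ a + δ b)
    (hδmul : ∀ a b : E, δ (a * b) = a * δ b + δ a * b)
    (F : Subfield E) (hF : ∀ x ∈ F, δ x ∈ F)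
    (r n m : ℕ) (u : Fin r → E) (ybar : Fin n → E)
    (hu : DiffIndep δ (diffAdjoin δ F (Set.range ybar)) u)
    (P : Fin m → MvPolynomial ((Fin r ⊕ Fin n) × ℕ) F)
    (ni : Fin m → ℕ) (σ : (i : Fin m) → Fin (ni i) → ℕ)
    (hdep : ¬ AlgebraicIndependent (diffAdjoin δ F (Set.range u))
      (fun p : Σ i : Fin m, Fin (ni i) =>
        δ^[σ p.1 p.2]
          (MvPolynomial.aeval (fun q => δ^[q.2] (Sum.elim u ybar q.1)) (P p.1))))
    (v : Fin r → F) :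
    ¬ AlgebraicIndependent F
      (fun p : Σ i : Fin m, Fin (ni i) =>
        δ^[σ p.1 p.2]
          (MvPolynomial.aeval
            (fun q => δ^[q.2] (Sum.elim (fun j => (v j : E)) ybar q.1)) (P p.1))) := by
  obtain ⟨D, rfl⟩ : ∃ D : Derivation ℤ E E, δ = D :=
    ⟨Derivation.mk' (AddMonoidHom.mk' δ hδadd).toIntLinearMap fun a b => by
      change δ (a * b) = a * δ b + b * δ a
      rw [hδmul, mul_comm (δ a)], rfl⟩
  set K := diffAdjoin D F (Set.range ybar)
  have hFK : F ≤ K := le_diffAdjoin _ _ _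
  have hK : ∀ x ∈ K, D x ∈ K := fun x hx => D.apply_mem_diffAdjoin hF hx
  have hvF (j : Fin r) (k : ℕ) : D^[k] (v j : E) ∈ F := iterate_mem_of_stable hF (v j).2 k
  let w : Fin r → E := fun j => u j - v j
  have hw (j : Fin r) (k : ℕ) : D^[k] (w j) = D^[k] (u j) - D^[k] (v j : E) :=
    iterate_map_sub D k _ _
  let : Algebra F K := (Subfield.inclusion hFK).toAlgebra
  have : IsScalarTower F K E := IsScalarTower.of_algebraMap_eq fun _ => rfl
  have hwK : AlgebraicIndependent K (fun p : Fin r × ℕ => D^[p.2] (w p.1)) := by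
    convert! hu.sub_algebraMap fun p => ⟨D^[p.2] (v p.1 : E), hFK (hvF p.1 p.2)⟩ using 2 with p
    exact hw p.1 p.2
  have base (f : MvPolynomial ((Fin r ⊕ Fin n) × ℕ) F) : ∃ q : MvPolynomial (Fin r × ℕ) K,
      MvPolynomial.aeval (fun i => D^[i.2] (w i.1)) q =
        MvPolynomial.aeval (fun q => D^[q.2] (Sum.elim u ybar q.1)) f ∧
      ((MvPolynomial.constantCoeff q : K) : E) =
        MvPolynomial.aeval (fun q => D^[q.2] (Sum.elim (fun j => (v j : E)) ybar q.1)) f := by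
    induction f using MvPolynomial.induction_on with
    | C a => exact ⟨MvPolynomial.C ⟨a, hFK a.2⟩, by simp [MvPolynomial.algHom_C, Subfield.algebraMap_eq_coe],
        by simp [MvPolynomial.algHom_C, Subfield.algebraMap_eq_coe]⟩
    | add p₁ p₂ h₁ h₂ =>
      obtain ⟨q₁, h₁, h₁'⟩ := h₁
      obtain ⟨q₂, h₂, h₂'⟩ := h₂
      exact ⟨q₁ + q₂, by simp only [map_add, h₁, h₂], by simp [h₁', h₂']⟩
    | mul_X p i hp =>
      obtain ⟨q, hq, hq'⟩ := hp
      obtain ⟨j | j, k⟩ := i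
      · refine ⟨q * (MvPolynomial.X (j, k) + MvPolynomial.C ⟨D^[k] (v j : E), hFK (hvF j k)⟩), ?_, by simp [hq']⟩
        rw [map_mul, hq]
        simp only [map_mul, map_add, MvPolynomial.aeval_X, MvPolynomial.algHom_C,
          Subfield.algebraMap_eq_coe, hw, sub_add_cancel, Sum.elim_inl]
      · refine ⟨q * MvPolynomial.C ⟨D^[k] (ybar j), iterate_mem_diffAdjoin D F (Set.mem_range_self j) k⟩, ?_, by simp [hq']⟩
        simp [hq, MvPolynomial.algHom_C, Subfield.algebraMap_eq_coe]
  have lift (p : Σ i : Fin m, Fin (ni i)) : ∃ q : MvPolynomial (Fin r × ℕ) K,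
      MvPolynomial.aeval (fun i => D^[i.2] (w i.1)) q = D^[σ p.1 p.2]
        (MvPolynomial.aeval (fun q => D^[q.2] (Sum.elim u ybar q.1)) (P p.1)) ∧
      ((MvPolynomial.constantCoeff q : K) : E) = D^[σ p.1 p.2]
        (MvPolynomial.aeval (fun q => D^[q.2] (Sum.elim (fun j => (v j : E)) ybar q.1)) (P p.1)) := by
    obtain ⟨q₀, h₀, h₀'⟩ := base (P p.1)
    obtain ⟨q, h, h'⟩ := D.exists_iterate_lift hK w q₀ (σ p.1 p.2)
    exact ⟨q, by rw [h, h₀], by rw [h', h₀']⟩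
  choose q hq hq' using lift
  intro hind
  simp_rw [← hq] at hdep
  simp_rw [← hq'] at hind
  have hconst : AlgebraicIndependent F (fun p => MvPolynomial.constantCoeff (q p)) :=
    AlgebraicIndependent.of_comp (IsScalarTower.toAlgHom F K E) hind
  have hsum := hconst.sumElim_X_of_constantCoeff.map'
    (f := (MvPolynomial.aeval fun i : Fin r × ℕ => D^[i.2] (w i.1) :
      MvPolynomial (Fin r × ℕ) K →ₐ[K] E).restrictScalars F) hwK
  have hind' : AlgebraicIndependent
      (IntermediateField.adjoin F (Set.range fun i : Fin r × ℕ => D^[i.2] (w i.1)))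
      (fun p => MvPolynomial.aeval (fun i : Fin r × ℕ => D^[i.2] (w i.1)) (q p)) := by
    apply AlgebraicIndependent.intermediateField_adjoin
    convert! hsum using 1
    ext (_ | _) <;> simp
  have hle : diffAdjoin D F (Set.range u) ≤
      (IntermediateField.adjoin F
        (Set.range fun i : Fin r × ℕ => D^[i.2] (w i.1))).toSubfield := by
    refine Subfield.closure_le.mpr ?_
    rintro x (hx | ⟨_, ⟨j, rfl⟩, k, rfl⟩)
    · exact (IntermediateField.adjoin F _).algebraMap_mem ⟨x, hx⟩
    · rw [← sub_add_cancel (D^[k] (u j)) (D^[k] (v j : E)), ← hw]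
      exact add_mem (IntermediateField.subset_adjoin F _ ⟨(j, k), rfl⟩)
        ((IntermediateField.adjoin F _).algebraMap_mem ⟨_, hvF j k⟩)
  let : Algebra (diffAdjoin D F (Set.range u))
      (IntermediateField.adjoin F (Set.range fun i : Fin r × ℕ => D^[i.2] (w i.1))) :=
    (Subfield.inclusion hle).toAlgebra
  have : IsScalarTower (diffAdjoin D F (Set.range u))
      (IntermediateField.adjoin F (Set.range fun i : Fin r × ℕ => D^[i.2] (w i.1))) E :=
    IsScalarTower.of_algebraMap_eq fun _ => rfl
  exact hdep (hind'.restrictScalars (Subfield.inclusion hle).injective)
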